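/- Let q ≥ 2 and α > -1/2. There is a constant C > 0 such that for all x, z > 0 with 0 < z < x/2 or z > 2x, (∫_{Γ₊(x)} |(s ∂/∂s W_s^α(y,z))|_{s=t²}|^q dt dy/t²)^{1/q} ≤ C / max(x, z), where Γ₊(x) = {(y,t) ∈ (0,∞)² : |y - x| < t}. -/

import Mathlib

open MeasureTheory Real

/-- The modified Bessel function of the first kind `I_a`. -/
noncomputable def besselI (a x : ℝ) : ℝ :=
  ∑' k : ℕ, (x / 2) ^ (2 * (k : ℝ) + a) / ((Nat.factorial k : ℝ) * Real.Gamma ((k : ℝ) + a + 1))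

/-- The Laguerre heat kernel `W_s^α(y,z)`. -/
noncomputable def laguerreHeatKernel (a s y z : ℝ) : ℝ :=
  (2 * Real.exp (-s) / (1 - Real.exp (-2 * s))) ^ ((1 : ℝ) / 2) *
    (2 * y * z * Real.exp (-s) / (1 - Real.exp (-2 * s))) ^ ((1 : ℝ) / 2) *
    besselI a (2 * y * z * Real.exp (-s) / (1 - Real.exp (-2 * s))) *
    Real.exp (-(1 / 2) * (y ^ 2 + z ^ 2) * (1 + Real.exp (-2 * s)) / (1 - Real.exp (-2 * s)))

/-- The Hermite (Mehler) heat kernel `W_s(x,y)`. -/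
noncomputable def hermiteHeatKernel (s x y : ℝ) : ℝ :=
  Real.pi ^ (-(1 : ℝ) / 2) * (Real.exp (-s) / (1 - Real.exp (-2 * s))) ^ ((1 : ℝ) / 2) *
    Real.exp (-((x - Real.exp (-s) * y) ^ 2 + (y - Real.exp (-s) * x) ^ 2) /
      (2 * (1 - Real.exp (-2 * s))))


noncomputable def bc (a : ℝ) (k : ℕ) : ℝ :=
  (1 / 2) ^ (2 * k) / ((Nat.factorial k : ℝ) * Real.Gamma ((k : ℝ) + a + 1))

noncomputable def bG (a x : ℝ) : ℝ := ∑' k : ℕ, bc a k * x ^ (2 * k)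

noncomputable def bG' (a x : ℝ) : ℝ := ∑' k : ℕ, bc a k * ((2 * k : ℕ) * x ^ (2 * k - 1))

lemma bc_nonneg {a : ℝ} (ha : -(1 / 2) < a) (k : ℕ) : 0 ≤ bc a k := by
  have hk : (0 : ℝ) ≤ k := Nat.cast_nonneg k
  have : 0 < Real.Gamma ((k : ℝ) + a + 1) := Real.Gamma_pos_of_pos (by linarith)
  unfold bc; positivity

lemma bc_mul_le {a : ℝ} (ha : -(1 / 2) < a) (k : ℕ) :
    bc a k * (Nat.factorial (2 * k) : ℝ) ≤ bc a 0 := by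
  induction k with
  | zero => simp
  | succ k ih =>
    refine le_trans ?_ ih
    have hk : (0 : ℝ) ≤ k := Nat.cast_nonneg k
    have hG : 0 < Real.Gamma ((k : ℝ) + a + 1) := Real.Gamma_pos_of_pos (by linarith)
    have h1 : Real.Gamma (((k + 1 : ℕ) : ℝ) + a + 1) = (k + a + 1) * Real.Gamma ((k : ℝ) + a + 1) := by
      rw [← Real.Gamma_add_one (by linarith)]; push_cast; ring_nf
    have h2 : bc a (k + 1) * (Nat.factorial (2 * (k + 1)) : ℝ)
        = bc a k * (Nat.factorial (2 * k) : ℝ) * ((k + 1 / 2) / (k + a + 1)) := by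
      unfold bc
      rw [h1, show 2 * (k + 1) = 2 * k + 1 + 1 by ring, Nat.factorial_succ, Nat.factorial_succ,
        Nat.factorial_succ]
      have : (k : ℝ) + a + 1 ≠ 0 := by linarith
      push_cast
      field_simp
      ring
    rw [h2]
    refine mul_le_of_le_one_right (mul_nonneg (bc_nonneg ha k) (by positivity)) ?_
    rw [div_le_one (by linarith)]
    linarith

lemma bc_le {a : ℝ} (ha : -(1 / 2) < a) (k : ℕ) :
    bc a k ≤ bc a 0 / (Nat.factorial (2 * k) : ℝ) := by
  rw [le_div_iff₀ (by positivity)]; exact bc_mul_le ha k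

lemma bG_summable {a : ℝ} (ha : -(1 / 2) < a) {x : ℝ} (hx : 0 ≤ x) :
    Summable (fun k : ℕ => bc a k * x ^ (2 * k)) := by
  refine Summable.of_nonneg_of_le (fun k => mul_nonneg (bc_nonneg ha k) (by positivity)) (fun k => ?_)
    ((Real.hasSum_cosh x).summable.mul_left (bc a 0))
  calc bc a k * x ^ (2 * k) ≤ bc a 0 / (Nat.factorial (2 * k) : ℝ) * x ^ (2 * k) := by
        gcongr; exact bc_le ha k
    _ = _ := by ring

lemma bG_le {a : ℝ} (ha : -(1 / 2) < a) {x : ℝ} (hx : 0 ≤ x) :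
    bG a x ≤ bc a 0 * Real.exp x := by
  have h := (Real.hasSum_cosh x).mul_left (bc a 0)
  have : bG a x ≤ bc a 0 * Real.cosh x := by
    refine hasSum_le (fun k => ?_) (bG_summable ha hx).hasSum h
    calc bc a k * x ^ (2 * k) ≤ bc a 0 / (Nat.factorial (2 * k) : ℝ) * x ^ (2 * k) := by
          gcongr; exact bc_le ha k
      _ = _ := by ring
  refine this.trans (mul_le_mul_of_nonneg_left ?_ (bc_nonneg ha 0))
  have := Real.sinh_nonneg_iff.2 hx
  have := Real.cosh_add_sinh x
  linarith

lemma bG_nonneg {a : ℝ} (ha : -(1 / 2) < a) {x : ℝ} (hx : 0 ≤ x) : 0 ≤ bG a x :=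
  tsum_nonneg fun k => mul_nonneg (bc_nonneg ha k) (by positivity)

lemma bG'_nonneg {a : ℝ} (ha : -(1 / 2) < a) {x : ℝ} (hx : 0 ≤ x) : 0 ≤ bG' a x :=
  tsum_nonneg fun k => mul_nonneg (bc_nonneg ha k) (by positivity)

lemma bG'_term {a : ℝ} (ha : -(1 / 2) < a) {x : ℝ} (hx : 0 ≤ x) (k : ℕ) :
    bc a (k + 1) * ((2 * (k + 1) : ℕ) * x ^ (2 * (k + 1) - 1))
      ≤ bc a 0 * (x ^ (2 * k + 1) / (Nat.factorial (2 * k + 1) : ℝ)) := by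
  have h := bc_le ha (k + 1)
  rw [show 2 * (k + 1) - 1 = 2 * k + 1 by omega]
  calc _ ≤ bc a 0 / (Nat.factorial (2 * (k + 1)) : ℝ) * ((2 * (k + 1) : ℕ) * x ^ (2 * k + 1)) := by
        gcongr
    _ = _ := by
      rw [show 2 * (k + 1) = 2 * k + 1 + 1 by ring, Nat.factorial_succ]
      push_cast
      field_simp

lemma bG'_summable {a : ℝ} (ha : -(1 / 2) < a) {x : ℝ} (hx : 0 ≤ x) :
    Summable (fun k : ℕ => bc a k * ((2 * k : ℕ) * x ^ (2 * k - 1))) := by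
  rw [← summable_nat_add_iff 1]
  exact Summable.of_nonneg_of_le (fun k => mul_nonneg (bc_nonneg ha _) (by positivity))
    (fun k => bG'_term ha hx k) ((Real.hasSum_sinh x).summable.mul_left (bc a 0))

lemma bG'_le {a : ℝ} (ha : -(1 / 2) < a) {x : ℝ} (hx : 0 ≤ x) :
    bG' a x ≤ bc a 0 * Real.exp x := by
  have h := (Real.hasSum_sinh x).mul_left (bc a 0)
  have : bG' a x ≤ bc a 0 * Real.sinh x := by
    unfold bG'
    rw [(bG'_summable ha hx).tsum_eq_zero_add]
    simp only [Nat.cast_zero, zero_mul, mul_zero, zero_add]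
    exact hasSum_le (fun k => bG'_term ha hx k)
      ((summable_nat_add_iff 1).2 (bG'_summable ha hx)).hasSum h
  refine this.trans (mul_le_mul_of_nonneg_left ?_ (bc_nonneg ha 0))
  have := Real.cosh_pos x
  have := Real.cosh_add_sinh x
  linarith

lemma bG_hasDerivAt {a : ℝ} (ha : -(1 / 2) < a) {x : ℝ} (hx : 0 < x) :
    HasDerivAt (bG a) (bG' a x) x := by
  have hmem : x ∈ Set.Ioo 0 (x + 1) := ⟨hx, by linarith⟩
  have hx1 : 0 ≤ x + 1 := by linarith
  refine hasDerivAt_tsum_of_isPreconnected (t := Set.Ioo 0 (x + 1)) (y₀ := x)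
    (g := fun (k : ℕ) (x : ℝ) => bc a k * x ^ (2 * k))
    (g' := fun (k : ℕ) (x : ℝ) => bc a k * ((2 * k : ℕ) * x ^ (2 * k - 1)))
    (bG'_summable ha hx1) isOpen_Ioo isPreconnected_Ioo
    (fun n y _ => ?_) (fun n y hy => ?_) hmem (bG_summable ha hx.le) hmem
  · exact (hasDerivAt_pow (2 * n) y).const_mul (bc a n)
  · have hy0 : 0 ≤ y := hy.1.le
    rw [Real.norm_of_nonneg (mul_nonneg (bc_nonneg ha _) (by positivity))]
    have := bc_nonneg ha n
    have := hy.2.le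
    gcongr

lemma besselI_eq {a x : ℝ} (hx : 0 < x) : besselI a x = (x / 2) ^ a * bG a x := by
  unfold besselI bG
  rw [← tsum_mul_left]
  congr 1; ext k
  rw [Real.rpow_add (by positivity), show (2 * (k : ℝ)) = ((2 * k : ℕ) : ℝ) by push_cast; ring,
    Real.rpow_natCast]
  unfold bc
  rw [div_eq_mul_one_div x 2, mul_pow]
  ring

lemma sinh_facts {s : ℝ} (hs : 0 < s) : s ≤ sinh s ∧ s ^ 3 / 6 ≤ sinh s ∧ sinh s ≤ s * cosh s ∧
    s * cosh s ≤ (1 + s) * sinh s ∧ 1 ≤ cosh s := by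
  have h1 : s ≤ sinh s := Real.self_le_sinh_iff.2 hs.le
  refine ⟨h1, ?_, ?_, ?_, Real.one_le_cosh s⟩
  · have := le_hasSum (Real.hasSum_sinh s) 1 (fun j _ => by positivity)
    norm_num [Nat.factorial] at this
    exact this
  · refine hasSum_le (fun n => ?_) (Real.hasSum_sinh s) ((Real.hasSum_cosh s).mul_left s)
    rw [Nat.factorial_succ, pow_succ, mul_comm (s ^ (2 * n)) s, mul_div_assoc]
    gcongr
    have : (0 : ℝ) < (2 * n).factorial := by positivity
    nlinarith [(Nat.cast_nonneg n : (0 : ℝ) ≤ n)]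
  · have h2 := Real.cosh_sub_sinh s
    have h3 : Real.exp (-s) ≤ 1 := Real.exp_le_one_iff.2 (by linarith)
    nlinarith

lemma rpow_exp_bdd (r c : ℝ) (hc : 0 < c) : ∃ D > 0, ∀ u : ℝ, 0 ≤ u → u ^ r * Real.exp (-(c * u)) ≤ D ∨ u < 1 := by
  obtain ⟨n, hn⟩ := exists_nat_ge r
  refine ⟨n.factorial / c ^ n, by positivity, fun u hu => ?_⟩
  by_cases h : u < 1
  · exact Or.inr h
  left
  push Not at h
  have h1 := Real.pow_div_factorial_le_exp (c * u) (by positivity) n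
  rw [Real.exp_neg, ← div_eq_mul_inv, div_le_iff₀ (Real.exp_pos _)]
  have h2 : u ^ r ≤ u ^ n := by
    rw [← Real.rpow_natCast]; exact Real.rpow_le_rpow_of_exponent_le h hn
  calc u ^ r ≤ u ^ n := h2
    _ = n.factorial / c ^ n * ((c * u) ^ n / n.factorial) := by
      rw [mul_pow]; field_simp
    _ ≤ _ := by gcongr

/-- polynomial factors are absorbed by the exponential -/
lemma absorb (p b c : ℝ) (hp : 0 < p) (hb : 0 < b) (hc : 0 < c) : ∃ D > 0, ∀ u : ℝ, 0 < u →
    u ^ p * (b + u) * Real.exp (-(c * u)) ≤ D / u := by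
  obtain ⟨D, hD, h⟩ := rpow_exp_bdd (p + 2) c hc
  refine ⟨D * (b + 1) + (b + 1), by positivity, fun u hu => ?_⟩
  rw [le_div_iff₀ hu]
  rcases h u hu.le with h | h
  · by_cases h1 : u < 1
    · have e1 : u ^ p ≤ 1 := Real.rpow_le_one hu.le h1.le hp.le
      have e2 : Real.exp (-(c * u)) ≤ 1 := Real.exp_le_one_iff.2 (by nlinarith)
      have : u ^ p * (b + u) * Real.exp (-(c * u)) * u ≤ 1 * (b + 1) * 1 * 1 := by gcongr
      nlinarith [mul_pos hD hb]
    push Not at h1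
    have e : u ^ (p + 2) = u ^ p * u * u := by
      rw [Real.rpow_add hu]; norm_num; ring
    have : u ^ p * (b + u) * Real.exp (-(c * u)) * u ≤ (b + 1) * (u ^ (p + 2) * Real.exp (-(c * u))) := by
      rw [e]
      have : b + u ≤ (b + 1) * u := by nlinarith
      calc u ^ p * (b + u) * Real.exp (-(c * u)) * u
          ≤ u ^ p * ((b + 1) * u) * Real.exp (-(c * u)) * u := by gcongr
        _ = _ := by ring
    nlinarith
  · have e1 : u ^ p ≤ 1 := Real.rpow_le_one hu.le h.le hp.le
    have e2 : Real.exp (-(c * u)) ≤ 1 := Real.exp_le_one_iff.2 (by nlinarith)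
    have : u ^ p * (b + u) * Real.exp (-(c * u)) * u ≤ 1 * (b + 1) * 1 * 1 := by gcongr
    nlinarith [mul_pos hD hb]

lemma kernel_eq {a s y z : ℝ} (hs : 0 < s) (hy : 0 < y) (hz : 0 < z) :
    laguerreHeatKernel a s y z = (2 : ℝ) ^ (-a) * (y * z) ^ (a + 1 / 2) *
      ((sinh s) ^ (-(a + 1)) * bG a (y * z / sinh s) *
        Real.exp (-((y ^ 2 + z ^ 2) / 2) * (cosh s / sinh s))) := by
  have hσ : 0 < sinh s := Real.sinh_pos_iff.2 hs
  have he : Real.exp (-2 * s) = Real.exp (-s) * Real.exp (-s) := by rw [← Real.exp_add]; ring_nf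
  have hes : Real.exp s * Real.exp (-s) = 1 := by rw [← Real.exp_add]; simp
  have hpos := Real.exp_pos (-s)
  have h1 : 1 - Real.exp (-2 * s) = 2 * Real.exp (-s) * sinh s := by
    rw [Real.sinh_eq, he]; linear_combination - hes
  have h2 : 1 + Real.exp (-2 * s) = 2 * Real.exp (-s) * cosh s := by
    rw [Real.cosh_eq, he]; linear_combination - hes
  unfold laguerreHeatKernel
  rw [h1, h2]
  have e1 : 2 * Real.exp (-s) / (2 * Real.exp (-s) * sinh s) = (sinh s)⁻¹ := by field_simp
  have e2 : 2 * y * z * Real.exp (-s) / (2 * Real.exp (-s) * sinh s) = y * z / sinh s := by field_simp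
  have e3 : -(1 / 2) * (y ^ 2 + z ^ 2) * (2 * Real.exp (-s) * cosh s) / (2 * Real.exp (-s) * sinh s)
      = -((y ^ 2 + z ^ 2) / 2) * (cosh s / sinh s) := by field_simp
  rw [e1, e2, e3, besselI_eq (by positivity)]
  have e4 : (sinh s)⁻¹ ^ ((1 : ℝ) / 2) * (y * z / sinh s) ^ ((1 : ℝ) / 2) * (y * z / sinh s / 2) ^ a
      = (2 : ℝ) ^ (-a) * (y * z) ^ (a + 1 / 2) * (sinh s) ^ (-(a + 1)) := by
    rw [Real.inv_rpow hσ.le, Real.div_rpow (by positivity) hσ.le, Real.div_rpow (by positivity) (by norm_num),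
      Real.div_rpow (by positivity) hσ.le, Real.rpow_neg (by norm_num), Real.rpow_neg hσ.le,
      Real.rpow_add (by positivity), show a + 1 = a + 1 / 2 + 1 / 2 by ring, Real.rpow_add hσ,
      Real.rpow_add hσ]
    field_simp
  linear_combination (bG a (y * z / sinh s) *
        Real.exp (-((y ^ 2 + z ^ 2) / 2) * (cosh s / sinh s))) * e4

lemma kernel_hasDerivAt {a s y z : ℝ} (ha : -(1 / 2) < a) (hs : 0 < s) (hy : 0 < y) (hz : 0 < z) :
    deriv (fun s => laguerreHeatKernel a s y z) s = (2 : ℝ) ^ (-a) * ((y * z / sinh s) ^ (a + 1 / 2) *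
      (sinh s) ^ (-(1 / 2) : ℝ) * Real.exp (-((y ^ 2 + z ^ 2) / 2) * (cosh s / sinh s)) *
      (-(a + 1) * (cosh s / sinh s) * bG a (y * z / sinh s)
        - (y * z / sinh s) * (cosh s / sinh s) * bG' a (y * z / sinh s)
        + (y ^ 2 + z ^ 2) / (2 * sinh s ^ 2) * bG a (y * z / sinh s))) := by
  have hσ : 0 < sinh s := Real.sinh_pos_iff.2 hs
  have hev : (fun s => laguerreHeatKernel a s y z) =ᶠ[nhds s] fun s => (2 : ℝ) ^ (-a) * (y * z) ^ (a + 1 / 2) *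
      ((sinh s) ^ (-(a + 1)) * bG a (y * z / sinh s) *
        Real.exp (-((y ^ 2 + z ^ 2) / 2) * (cosh s / sinh s))) := by
    filter_upwards [lt_mem_nhds hs] with r hr
    exact kernel_eq hr hy hz
  rw [hev.deriv_eq]
  have d1 : HasDerivAt (fun s => (sinh s) ^ (-(a + 1))) (cosh s * (-(a + 1)) * sinh s ^ (-(a + 1) - 1)) s :=
    (Real.hasDerivAt_sinh s).rpow_const (Or.inl hσ.ne')
  have d2 : HasDerivAt (fun s => y * z / sinh s) (-(y * z * cosh s) / sinh s ^ 2) s := by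
    have h := (hasDerivAt_const s (y * z)).div (Real.hasDerivAt_sinh s) hσ.ne'
    have e : (0 * sinh s - y * z * cosh s) / sinh s ^ 2 = -(y * z * cosh s) / sinh s ^ 2 := by ring
    rw [e] at h
    exact h
  have d3 : HasDerivAt (fun s => bG a (y * z / sinh s)) (bG' a (y * z / sinh s) * (-(y * z * cosh s) / sinh s ^ 2)) s :=
    HasDerivAt.comp s (bG_hasDerivAt ha (by positivity)) d2
  have d4 : HasDerivAt (fun s => cosh s / sinh s) (-1 / sinh s ^ 2) s := by
    have h := (Real.hasDerivAt_cosh s).div (Real.hasDerivAt_sinh s) hσ.ne'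
    have e : sinh s * sinh s - cosh s * cosh s = -1 := by
      linear_combination - Real.cosh_sq s
    rw [e] at h
    exact h
  have d5 := (d4.const_mul (-((y ^ 2 + z ^ 2) / 2))).exp
  have d := ((d1.mul d3).mul d5).const_mul ((2 : ℝ) ^ (-a) * (y * z) ^ (a + 1 / 2))
  refine (HasDerivAt.deriv d).trans ?_
  have p1 : sinh s ^ (-(a + 1) - 1) = sinh s ^ (-(a + 1)) / sinh s := by
    rw [Real.rpow_sub hσ, Real.rpow_one]
  have p2 : (y * z / sinh s) ^ (a + 1 / 2) * (sinh s) ^ (-(1 / 2) : ℝ)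
      = (y * z) ^ (a + 1 / 2) * (sinh s) ^ (-(a + 1)) := by
    rw [Real.div_rpow (by positivity) hσ.le, show -(a + 1) = -(a + 1 / 2) + -(1 / 2) by ring,
      Real.rpow_add hσ (-(a + 1 / 2)), Real.rpow_neg hσ.le (a + 1 / 2)]
    ring
  rw [p2, p1]
  simp only [Pi.mul_apply]
  field_simp
  ring

lemma kernel_bound {a : ℝ} (ha : -(1 / 2) < a) {t y z : ℝ} (ht : 0 < t) (hy : 0 < y) (hz : 0 < z) :
    |t ^ 2 * deriv (fun s => laguerreHeatKernel a s y z) (t ^ 2)| ≤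
      (2 : ℝ) ^ (-a) * bc a 0 * 4 * (1 / t) *
        (((y ^ 2 + z ^ 2) / t ^ 2) ^ (a + 1 / 2) * ((a + 1) + (y ^ 2 + z ^ 2) / t ^ 2) *
        Real.exp (-(((y ^ 2 + z ^ 2) * cosh (t ^ 2) - 2 * (y * z)) / (2 * sinh (t ^ 2))))) := by
  have hs : 0 < t ^ 2 := by positivity
  rw [kernel_hasDerivAt ha hs hy hz]
  obtain ⟨s, hse⟩ : ∃ s, s = t ^ 2 := ⟨_, rfl⟩
  have hts : t = Real.sqrt s := by rw [hse, Real.sqrt_sq ht.le]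
  rw [← hse] at hs ⊢
  obtain ⟨h1, h2, h3, h4, h5⟩ := sinh_facts hs
  have hσ : 0 < sinh s := Real.sinh_pos_iff.2 hs
  obtain ⟨σ, hσe⟩ : ∃ σ, σ = sinh s := ⟨_, rfl⟩
  obtain ⟨κ, hκe⟩ : ∃ κ, κ = cosh s := ⟨_, rfl⟩
  rw [← hσe] at h1 h2 h3 h4 hσ ⊢
  rw [← hκe] at h3 h4 h5 ⊢
  obtain ⟨N, hN⟩ : ∃ N, N = y ^ 2 + z ^ 2 := ⟨_, rfl⟩
  rw [← hN]
  have hNpos : 0 < N := by rw [hN]; positivity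
  obtain ⟨ξ, hξ⟩ : ∃ ξ, ξ = y * z / σ := ⟨_, rfl⟩
  rw [← hξ]
  have hξ0 : 0 < ξ := by rw [hξ]; positivity
  obtain ⟨u, hu⟩ : ∃ u, u = N / s := ⟨_, rfl⟩
  rw [← hu]
  have hu0 : 0 < u := by rw [hu]; positivity
  have hξu : 2 * ξ ≤ u := by
    rw [hξ, hu]
    calc 2 * (y * z / σ) = (2 * (y * z)) / σ := by ring
      _ ≤ N / σ := by gcongr; rw [hN]; nlinarith [sq_nonneg (y - z)]
      _ ≤ N / s := by gcongr
  have hB := bc_nonneg ha 0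
  have hG := bG_le ha hξ0.le
  have hG0 := bG_nonneg ha hξ0.le
  have hG' := bG'_le ha hξ0.le
  have hG'0 := bG'_nonneg ha hξ0.le
  have hκ : 0 < κ / σ := by positivity
  have hE : Real.exp (-(N / 2) * (κ / σ)) * Real.exp ξ = Real.exp (-((N * κ - 2 * (y * z)) / (2 * σ))) := by
    rw [← Real.exp_add, hξ]; congr 1; field_simp; ring
  have ha1 : 0 < a + 1 := by linarith
  -- the bracket
  have hbr : s * |-(a + 1) * (κ / σ) * bG a ξ - ξ * (κ / σ) * bG' a ξ + N / (2 * σ ^ 2) * bG a ξ|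
      ≤ (1 + s) * ((a + 1) + u) * (bc a 0 * Real.exp ξ) := by
    have hsk : s * (κ / σ) ≤ 1 + s := by
      rw [← mul_div_assoc, div_le_iff₀ hσ]; exact h4
    have hsN : s * (N / (2 * σ ^ 2)) ≤ u / 2 := by
      rw [hu]
      calc s * (N / (2 * σ ^ 2)) ≤ s * (N / (2 * s ^ 2)) := by gcongr
        _ = N / s / 2 := by field_simp
    have hX : |-(a + 1) * (κ / σ) * bG a ξ - ξ * (κ / σ) * bG' a ξ + N / (2 * σ ^ 2) * bG a ξ|
        ≤ (a + 1) * (κ / σ) * bG a ξ + ξ * (κ / σ) * bG' a ξ + N / (2 * σ ^ 2) * bG a ξ := by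
      have q1 : 0 ≤ (a + 1) * (κ / σ) * bG a ξ := by positivity
      have q2 : 0 ≤ ξ * (κ / σ) * bG' a ξ := by positivity
      have q3 : 0 ≤ N / (2 * σ ^ 2) * bG a ξ := by positivity
      rw [abs_le]; constructor <;> linarith
    calc _ ≤ s * ((a + 1) * (κ / σ) * bG a ξ + ξ * (κ / σ) * bG' a ξ + N / (2 * σ ^ 2) * bG a ξ) := by gcongr
      _ = (a + 1) * (s * (κ / σ)) * bG a ξ + ξ * (s * (κ / σ)) * bG' a ξ + s * (N / (2 * σ ^ 2)) * bG a ξ := by ring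
      _ ≤ (a + 1) * (1 + s) * (bc a 0 * Real.exp ξ) + (u / 2) * (1 + s) * (bc a 0 * Real.exp ξ)
          + (u / 2 * (1 + s)) * (bc a 0 * Real.exp ξ) := by
        have r1 : ξ ≤ u / 2 := by linarith
        have r2 : s * (N / (2 * σ ^ 2)) ≤ u / 2 * (1 + s) := by
          refine hsN.trans ?_
          nlinarith
        have r3 : 0 < s * (κ / σ) := by positivity
        have r4 : 0 < s * (N / (2 * σ ^ 2)) := by positivity
        refine add_le_add (add_le_add ?_ ?_) ?_
        · exact mul_le_mul (mul_le_mul_of_nonneg_left hsk ha1.le) hG hG0 (by positivity)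
        · exact mul_le_mul (mul_le_mul r1 hsk r3.le (by positivity)) hG' hG'0 (by positivity)
        · exact mul_le_mul r2 hG hG0 (by positivity)
      _ = _ := by ring
  have hσs : (1 + s) * σ ^ (-(1 / 2) : ℝ) ≤ 4 * (1 / t) := by
    rw [Real.rpow_neg hσ.le, ← Real.sqrt_eq_rpow, ← div_eq_mul_inv, div_le_iff₀ (Real.sqrt_pos.2 hσ),
      mul_one_div, div_mul_eq_mul_div, le_div_iff₀ ht]
    refine abs_le_of_sq_le_sq' ?_ (by positivity) |>.2
    rw [mul_pow, mul_pow, Real.sq_sqrt hσ.le, ← hse]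
    nlinarith [mul_nonneg hs.le (sq_nonneg (s - 1))]
  have hξp : ξ ^ (a + 1 / 2) ≤ u ^ (a + 1 / 2) :=
    Real.rpow_le_rpow hξ0.le (by linarith) (by linarith)
  have hB2 : (0 : ℝ) < (2 : ℝ) ^ (-a) := by positivity
  rw [abs_mul, abs_mul, abs_mul, abs_mul, abs_mul, abs_of_pos hs, abs_of_pos hB2, abs_of_pos (by positivity : 0 < ξ ^ (a + 1 / 2)),
    abs_of_pos (by positivity : 0 < σ ^ (-(1 / 2) : ℝ)), abs_of_pos (Real.exp_pos _)]
  calc _ = (2 : ℝ) ^ (-a) * ξ ^ (a + 1 / 2) * σ ^ (-(1 / 2) : ℝ) * Real.exp (-(N / 2) * (κ / σ)) *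
        (s * |-(a + 1) * (κ / σ) * bG a ξ - ξ * (κ / σ) * bG' a ξ + N / (2 * σ ^ 2) * bG a ξ|) := by ring
    _ ≤ (2 : ℝ) ^ (-a) * u ^ (a + 1 / 2) * σ ^ (-(1 / 2) : ℝ) * Real.exp (-(N / 2) * (κ / σ)) *
        ((1 + s) * ((a + 1) + u) * (bc a 0 * Real.exp ξ)) := by gcongr
    _ = (2 : ℝ) ^ (-a) * bc a 0 * ((1 + s) * σ ^ (-(1 / 2) : ℝ)) * (u ^ (a + 1 / 2) * ((a + 1) + u) *
        (Real.exp (-(N / 2) * (κ / σ)) * Real.exp ξ)) := by ring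
    _ ≤ (2 : ℝ) ^ (-a) * bc a 0 * (4 * (1 / t)) * (u ^ (a + 1 / 2) * ((a + 1) + u) *
        (Real.exp (-(N / 2) * (κ / σ)) * Real.exp ξ)) := by gcongr
    _ = _ := by rw [hE]; ring

set_option maxHeartbeats 1000000 in
lemma pointwise {a : ℝ} (ha : -(1 / 2) < a) : ∃ C > 0, ∀ x z y t : ℝ, 0 < x → 0 < z → (z < x / 2 ∨ 2 * x < z) →
    0 < y → 0 < t → |y - x| < t →
    |t ^ 2 * deriv (fun s => laguerreHeatKernel a s y z) (t ^ 2)| ≤ C * (t / (max x z ^ 2 + t ^ 2)) := by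
  have ha1 : 0 < a + 1 := by linarith
  have ha2 : 0 < a + 1 / 2 := by linarith
  obtain ⟨D, hD, hab⟩ := absorb (a + 1 / 2) (a + 1) (1 / 50) ha2 ha1 (by norm_num)
  set B : ℝ := (2 : ℝ) ^ (-a) * bc a 0 * 4 with hBdef
  have hB : 0 ≤ B := by have := bc_nonneg ha 0; positivity
  set F : ℝ := (41 : ℝ) ^ (a + 1 / 2) * ((a + 1) + 41) with hF
  have hF0 : 0 < F := by positivity
  refine ⟨B * (17 * F) + B * (2 * D) + 1, by positivity, fun x z y t hx hz hxz hy ht hyx => ?_⟩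
  refine (kernel_bound ha ht hy hz).trans ?_
  rw [← hBdef]
  have hs : 0 < t ^ 2 := by positivity
  obtain ⟨h1, h2, h3, h4, h5⟩ := sinh_facts hs
  have hσ : 0 < sinh (t ^ 2) := Real.sinh_pos_iff.2 hs
  generalize sinh (t ^ 2) = σ at *
  generalize cosh (t ^ 2) = κ at *
  set M := max x z with hM
  have hMx : x ≤ M := le_max_left _ _
  have hMz : z ≤ M := le_max_right _ _
  have hM0 : 0 < M := lt_of_lt_of_le hx hMx
  rw [abs_lt] at hyx
  set N := y ^ 2 + z ^ 2 with hN
  have hN0 : 0 < N := by positivity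
  have hyz : 2 * (y * z) ≤ N := by rw [hN]; nlinarith [sq_nonneg (y - z)]
  have hT : 0 < t / (M ^ 2 + t ^ 2) := by positivity
  rcases le_or_gt M (4 * t) with hc | hc
  · have hu : N / t ^ 2 ≤ 41 := by
      rw [div_le_iff₀ hs, hN]
      have : y ≤ 5 * t := by linarith
      nlinarith
    have he : Real.exp (-((N * κ - 2 * (y * z)) / (2 * σ))) ≤ 1 := by
      rw [Real.exp_le_one_iff, neg_nonpos]
      apply div_nonneg _ (by positivity)
      nlinarith
    have ht' : 1 / t ≤ 17 * (t / (M ^ 2 + t ^ 2)) := by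
      rw [← mul_div_assoc, div_le_div_iff₀ ht (by positivity)]
      nlinarith
    calc _ ≤ B * (17 * (t / (M ^ 2 + t ^ 2))) * ((41 : ℝ) ^ (a + 1 / 2) * ((a + 1) + 41) * 1) := by gcongr
      _ = B * (17 * F) * (t / (M ^ 2 + t ^ 2)) := by rw [hF]; ring
      _ ≤ _ := by
        apply mul_le_mul_of_nonneg_right _ hT.le
        have : 0 ≤ B * (2 * D) := by positivity
        linarith
  · have key : 2 * (y * z) ≤ 24 / 25 * N ∧ 9 / 16 * M ^ 2 ≤ N := by
      rcases hxz with h | h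
      · have e : M = x := max_eq_left (by linarith)
        rw [e] at hc ⊢
        have g1 : 3 / 4 * x ≤ y := by linarith
        have g2 : z ≤ 2 / 3 * y := by linarith
        rw [hN]
        constructor
        · nlinarith [mul_nonneg (sub_nonneg.2 g2) (by linarith : (0 : ℝ) ≤ 4 / 3 * y - z)]
        · nlinarith
      · have e : M = z := max_eq_right (by linarith)
        rw [e] at hc ⊢
        have g2 : y ≤ 3 / 4 * z := by linarith
        rw [hN]
        constructor
        · nlinarith [mul_nonneg (sub_nonneg.2 g2) (by linarith : (0 : ℝ) ≤ 4 / 3 * z - y)]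
        · have := sq_nonneg y
          have := sq_nonneg z
          linarith
    obtain ⟨k1, k2⟩ := key
    have he : Real.exp (-((N * κ - 2 * (y * z)) / (2 * σ))) ≤ Real.exp (-(1 / 50 * (N / t ^ 2))) := by
      apply Real.exp_le_exp.2
      apply neg_le_neg
      calc 1 / 50 * (N / t ^ 2) ≤ 1 / 50 * (N * κ / σ) := by
            gcongr 1 / 50 * ?_
            rw [div_le_div_iff₀ hs hσ]
            calc N * σ ≤ N * (t ^ 2 * κ) := by gcongr
              _ = _ := by ring
        _ = (N * κ - 24 / 25 * (N * κ)) / (2 * σ) := by field_simp; ring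
        _ ≤ _ := by
          have r1 : N ≤ N * κ := le_mul_of_one_le_right hN0.le h5
          apply div_le_div_of_nonneg_right _ (by positivity)
          linarith
    have hu0 : 0 < N / t ^ 2 := by positivity
    have hfin : 1 / t * (D / (N / t ^ 2)) ≤ 2 * D * (t / (M ^ 2 + t ^ 2)) := by
      have e : 1 / t * (D / (N / t ^ 2)) = D * (t / N) := by field_simp
      have e2 : t / N ≤ 2 * (t / (M ^ 2 + t ^ 2)) := by
        rw [← mul_div_assoc, div_le_div_iff₀ hN0 (by positivity)]
        have r0 : t ^ 2 ≤ (M / 4) ^ 2 := pow_le_pow_left₀ ht.le (by linarith) 2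
        have r0' : (M / 4) ^ 2 = M ^ 2 / 16 := by ring
        have r00 : 0 ≤ M ^ 2 := sq_nonneg M
        have r1 : M ^ 2 + t ^ 2 ≤ 2 * N := by linarith
        calc t * (M ^ 2 + t ^ 2) ≤ t * (2 * N) := mul_le_mul_of_nonneg_left r1 ht.le
          _ = _ := by ring
      rw [e]
      calc D * (t / N) ≤ D * (2 * (t / (M ^ 2 + t ^ 2))) := mul_le_mul_of_nonneg_left e2 hD.le
        _ = _ := by ring
    calc _ ≤ B * (1 / t) * ((N / t ^ 2) ^ (a + 1 / 2) * ((a + 1) + N / t ^ 2) * Real.exp (-(1 / 50 * (N / t ^ 2)))) := by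
          gcongr
      _ ≤ B * (1 / t) * (D / (N / t ^ 2)) := by
          gcongr
          exact hab _ hu0
      _ = B * (1 / t * (D / (N / t ^ 2))) := by ring
      _ ≤ B * (2 * D * (t / (M ^ 2 + t ^ 2))) := by gcongr
      _ = B * (2 * D) * (t / (M ^ 2 + t ^ 2)) := by ring
      _ ≤ _ := by
        apply mul_le_mul_of_nonneg_right _ hT.le
        have : 0 ≤ B * (17 * F) := by positivity
        linarith

lemma cone_lintegral {x M : ℝ} (hM : 0 < M) :
    ∫⁻ p in {p : ℝ × ℝ | 0 < p.1 ∧ 0 < p.2 ∧ |p.1 - x| < p.2},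
      ENNReal.ofReal (1 / (M ^ 2 + p.2 ^ 2) ^ 2) ≤ ENNReal.ofReal (1 / M ^ 2) := by
  have hS : MeasurableSet {p : ℝ × ℝ | 0 < p.1 ∧ 0 < p.2 ∧ |p.1 - x| < p.2} := by
    apply IsOpen.measurableSet
    apply IsOpen.and (isOpen_lt continuous_const continuous_fst)
    apply IsOpen.and (isOpen_lt continuous_const continuous_snd)
    exact isOpen_lt (by fun_prop) continuous_snd
  have hmeas : Measurable (fun p : ℝ × ℝ => ENNReal.ofReal (1 / (M ^ 2 + p.2 ^ 2) ^ 2)) := by fun_prop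
  have hd : ∀ t : ℝ, HasDerivAt (fun t => -1 / (M ^ 2 + t ^ 2)) (1 / (M ^ 2 + t ^ 2) ^ 2 * (2 * t)) t := by
    intro t
    have hne : M ^ 2 + t ^ 2 ≠ 0 := by positivity
    have h := (hasDerivAt_const t (-1 : ℝ)).div ((hasDerivAt_pow 2 t).const_add (M ^ 2)) hne
    have e : (0 * (M ^ 2 + t ^ 2) - -1 * (((2 : ℕ) : ℝ) * t ^ (2 - 1))) / (M ^ 2 + t ^ 2) ^ 2
        = 1 / (M ^ 2 + t ^ 2) ^ 2 * (2 * t) := by norm_num; ring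
    rw [e] at h
    exact h
  have hlim : Filter.Tendsto (fun t : ℝ => -1 / (M ^ 2 + t ^ 2)) Filter.atTop (nhds 0) := by
    apply Filter.Tendsto.const_div_atTop
    exact Filter.tendsto_atTop_add_const_left _ _ (Filter.tendsto_pow_atTop (by norm_num))
  have hnn : ∀ t ∈ Set.Ioi (0 : ℝ), 0 ≤ 1 / (M ^ 2 + t ^ 2) ^ 2 * (2 * t) := by
    intro t ht
    have : (0 : ℝ) < t := ht
    positivity
  have hI := integral_Ioi_of_hasDerivAt_of_nonneg (hd 0).continuousAt.continuousWithinAt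
    (fun t _ => hd t) hnn hlim
  have hIn := integrableOn_Ioi_deriv_of_nonneg (hd 0).continuousAt.continuousWithinAt
    (fun t _ => hd t) hnn hlim
  rw [← lintegral_indicator hS, Measure.volume_eq_prod, lintegral_prod_symm _ (hmeas.indicator hS).aemeasurable]
  calc _ ≤ ∫⁻ t, (Set.Ioi (0 : ℝ)).indicator (fun t => ENNReal.ofReal (1 / (M ^ 2 + t ^ 2) ^ 2 * (2 * t))) t := by
        refine lintegral_mono fun t => ?_
        by_cases ht : 0 < t
        · rw [Set.indicator_of_mem (show t ∈ Set.Ioi (0 : ℝ) from ht)]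
          calc _ ≤ ∫⁻ y, (Set.Ioo (x - t) (x + t)).indicator
                (fun _ => ENNReal.ofReal (1 / (M ^ 2 + t ^ 2) ^ 2)) y := by
                refine lintegral_mono fun y => ?_
                by_cases hyt : (y, t) ∈ {p : ℝ × ℝ | 0 < p.1 ∧ 0 < p.2 ∧ |p.1 - x| < p.2}
                · have h2 := abs_lt.1 hyt.2.2
                  have h3 : y ∈ Set.Ioo (x - t) (x + t) := by
                    constructor
                    · have := h2.1; simp only at this; linarith
                    · have := h2.2; simp only at this; linarith
                  rw [Set.indicator_of_mem hyt, Set.indicator_of_mem h3]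
                · rw [Set.indicator_of_notMem hyt]
                  exact bot_le
            _ = _ := by
              rw [lintegral_indicator measurableSet_Ioo, setLIntegral_const, Real.volume_Ioo,
                ← ENNReal.ofReal_mul (by positivity)]
              congr 2; ring
        · rw [Set.indicator_of_notMem (show t ∉ Set.Ioi (0 : ℝ) from ht)]
          have : ∀ y : ℝ, (y, t) ∉ {p : ℝ × ℝ | 0 < p.1 ∧ 0 < p.2 ∧ |p.1 - x| < p.2} :=
            fun y h => ht h.2.1
          simp only [Set.indicator_of_notMem (this _), lintegral_zero, le_refl]
    _ = ENNReal.ofReal (1 / M ^ 2) := by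
        rw [lintegral_indicator measurableSet_Ioi, ← ofReal_integral_eq_lintegral_ofReal hIn
          ((ae_restrict_iff' measurableSet_Ioi).2 (Filter.Eventually.of_forall hnn)), hI]
        congr 1
        norm_num
        ring

lemma cone_integral {x M : ℝ} (hM : 0 < M) :
    IntegrableOn (fun p : ℝ × ℝ => 1 / (M ^ 2 + p.2 ^ 2) ^ 2)
      {p : ℝ × ℝ | 0 < p.1 ∧ 0 < p.2 ∧ |p.1 - x| < p.2} ∧
    ∫ p in {p : ℝ × ℝ | 0 < p.1 ∧ 0 < p.2 ∧ |p.1 - x| < p.2},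
      1 / (M ^ 2 + p.2 ^ 2) ^ 2 ≤ 1 / M ^ 2 := by
  have hmeas : Measurable (fun p : ℝ × ℝ => 1 / (M ^ 2 + p.2 ^ 2) ^ 2) := by fun_prop
  have h := cone_lintegral (x := x) hM
  have hnn : ∀ p : ℝ × ℝ, 0 ≤ 1 / (M ^ 2 + p.2 ^ 2) ^ 2 := fun p => by positivity
  refine ⟨⟨hmeas.aestronglyMeasurable, ?_⟩, ?_⟩
  · rw [hasFiniteIntegral_iff_ofReal (Filter.Eventually.of_forall hnn)]
    exact h.trans_lt ENNReal.ofReal_lt_top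
  · rw [integral_eq_lintegral_of_nonneg_ae (Filter.Eventually.of_forall hnn) hmeas.aestronglyMeasurable]
    exact ENNReal.toReal_le_of_le_ofReal (by positivity) h

theorem stmt16 (q : ℝ) (hq : 2 ≤ q) (a : ℝ) (ha : -(1 / 2) < a) :
    ∃ C > 0, ∀ x z : ℝ, 0 < x → 0 < z → (z < x / 2 ∨ 2 * x < z) →
      (∫ p in {p : ℝ × ℝ | 0 < p.1 ∧ 0 < p.2 ∧ |p.1 - x| < p.2},
          |p.2 ^ 2 * deriv (fun s => laguerreHeatKernel a s p.1 z) (p.2 ^ 2)| ^ q / p.2 ^ 2) ^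
        (1 / q) ≤ C / max x z := by
  obtain ⟨C, hC, hpt⟩ := pointwise ha
  refine ⟨C, hC, fun x z hx hz hxz => ?_⟩
  have hM : 0 < max x z := lt_max_of_lt_left hx
  obtain ⟨hint, hle⟩ := cone_integral (x := x) hM
  have hq0 : 0 < q := by linarith
  have hS : MeasurableSet {p : ℝ × ℝ | 0 < p.1 ∧ 0 < p.2 ∧ |p.1 - x| < p.2} := by
    apply IsOpen.measurableSet
    apply IsOpen.and (isOpen_lt continuous_const continuous_fst)
    apply IsOpen.and (isOpen_lt continuous_const continuous_snd)
    exact isOpen_lt (by fun_prop) continuous_snd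
  have main : (∫ p in {p : ℝ × ℝ | 0 < p.1 ∧ 0 < p.2 ∧ |p.1 - x| < p.2},
      |p.2 ^ 2 * deriv (fun s => laguerreHeatKernel a s p.1 z) (p.2 ^ 2)| ^ q / p.2 ^ 2)
      ≤ (C / max x z) ^ q := by
    replace hpt := fun y t => hpt x z y t hx hz hxz
    generalize max x z = M at *
    calc _ ≤ ∫ p in {p : ℝ × ℝ | 0 < p.1 ∧ 0 < p.2 ∧ |p.1 - x| < p.2},
          C ^ q * (1 / M) ^ (q - 2) * (1 / (M ^ 2 + p.2 ^ 2) ^ 2) := by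
          refine integral_mono_of_nonneg (Filter.Eventually.of_forall fun p => by positivity)
            (hint.const_mul _) ?_
          refine (ae_restrict_iff' hS).2 (Filter.Eventually.of_forall ?_)
          rintro ⟨y, t⟩ ⟨hy, ht, hyt⟩
          simp only at hy ht hyt ⊢
          have h := hpt y t hy ht hyt
          have hR : t / (M ^ 2 + t ^ 2) ≤ 1 / M := by
            rw [div_le_div_iff₀ (by positivity) hM]
            nlinarith [sq_nonneg (M - t)]
          rw [div_le_iff₀ (by positivity)]
          calc _ ≤ (C * (t / (M ^ 2 + t ^ 2))) ^ q := Real.rpow_le_rpow (abs_nonneg _) h hq0.le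
            _ = C ^ q * ((t / (M ^ 2 + t ^ 2)) ^ (q - 2) * (t / (M ^ 2 + t ^ 2)) ^ (2 : ℕ)) := by
              rw [Real.mul_rpow hC.le (by positivity), ← Real.rpow_natCast (t / (M ^ 2 + t ^ 2)) 2,
                ← Real.rpow_add (by positivity)]
              norm_num
            _ ≤ C ^ q * ((1 / M) ^ (q - 2) * (t / (M ^ 2 + t ^ 2)) ^ (2 : ℕ)) := by
              have := Real.rpow_le_rpow (by positivity) hR (by linarith : 0 ≤ q - 2)
              gcongr
            _ = _ := by rw [div_pow]; ring
      _ = C ^ q * (1 / M) ^ (q - 2) * ∫ p in {p : ℝ × ℝ | 0 < p.1 ∧ 0 < p.2 ∧ |p.1 - x| < p.2},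
          (1 / (M ^ 2 + p.2 ^ 2) ^ 2) := integral_const_mul _ _
      _ ≤ C ^ q * (1 / M) ^ (q - 2) * (1 / M ^ 2) := by gcongr
      _ = _ := by
        rw [div_eq_mul_one_div C M, Real.mul_rpow hC.le (by positivity),
          show (1 / M) ^ q = (1 / M) ^ (q - 2) * (1 / M) ^ (2 : ℕ) by
            rw [← Real.rpow_natCast _ 2, ← Real.rpow_add (by positivity)]; norm_num]
        ring
  calc _ ≤ ((C / max x z) ^ q) ^ (1 / q) := by
        refine Real.rpow_le_rpow ?_ main (by positivity)
        exact integral_nonneg fun p => by positivity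
    _ = C / max x z := by
        rw [← Real.rpow_mul (by positivity), mul_one_div_cancel hq0.ne', Real.rpow_one]
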